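/- arXiv:2604.15307 — 6 statements merged into one kernel-verified Lean document; each statement's English description precedes it below -/
import Mathlib

section
/- With the APM parent-matrix setup, for all block-row indices 0 ≤ i, k ≤ L/2 − 1, the (i,k) block of Ĥ_X Ĥ_Z^T equals Ψ_{(k−i) mod (L/2)}. Consequently, letting Δ := {(k−i) mod (L/2) : 0 ≤ i, k ≤ J−1}, if Ψ_r = 0 for every r ∈ Δ then the active matrices satisfy H_X H_Z^T = 0. -/
/-!
STATEMENT 1: APM parent-matrix setup with `ℓ = L/2` block rows.  The `(i,k)`
block of `Ĥ_X Ĥ_Z^T` equals `Ψ_{k−i}` (indices in `ZMod ℓ`), and if `Ψ_r = 0`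
for every `r ∈ Δ = {(k−i) mod ℓ : 0 ≤ i,k ≤ J−1}`, then the active matrices
(first `J` block rows) satisfy `H_X H_Z^T = 0`.
-/

open Matrix

/-- The `P×P` permutation matrix of a permutation `σ` (columns mapped by `σ`):
`M e_q = e_{σ q}`. -/
def permMat {P : ℕ} (σ : Equiv.Perm (Fin P)) : Matrix (Fin P) (Fin P) (ZMod 2) :=
  fun p q => if σ q = p then 1 else 0

/-- A matrix is a permutation matrix. -/
def IsPermMat {P : ℕ} (M : Matrix (Fin P) (Fin P) (ZMod 2)) : Prop :=
  ∃ σ : Equiv.Perm (Fin P), M = permMat σ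

/-- The parent matrix `Ĥ_X`: block `(i, inl j) = F_{j−i}`,
block `(i, inr j) = G_{j−i}`, block indices modulo `ℓ = L/2`. -/
def parentHX (ℓ P : ℕ) (F G : ZMod ℓ → Matrix (Fin P) (Fin P) (ZMod 2)) :
    Matrix (ZMod ℓ × Fin P) ((ZMod ℓ ⊕ ZMod ℓ) × Fin P) (ZMod 2) :=
  fun ip jq =>
    match jq with
    | (Sum.inl j, q) => F (j - ip.1) ip.2 q
    | (Sum.inr j, q) => G (j - ip.1) ip.2 q

/-- The parent matrix `Ĥ_Z`: block `(i, inl j) = G_{i−j}ᵀ`,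
block `(i, inr j) = F_{i−j}ᵀ`, block indices modulo `ℓ = L/2`. -/
def parentHZ (ℓ P : ℕ) (F G : ZMod ℓ → Matrix (Fin P) (Fin P) (ZMod 2)) :
    Matrix (ZMod ℓ × Fin P) ((ZMod ℓ ⊕ ZMod ℓ) × Fin P) (ZMod 2) :=
  fun ip jq =>
    match jq with
    | (Sum.inl j, q) => (G (ip.1 - j)).transpose ip.2 q
    | (Sum.inr j, q) => (F (ip.1 - j)).transpose ip.2 q

/-- `Ψ_r := Σ_u (F_u G_{r−u} + G_{r−u} F_u)` over `F_2`. -/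
def Psi (ℓ P : ℕ) [NeZero ℓ] (F G : ZMod ℓ → Matrix (Fin P) (Fin P) (ZMod 2))
    (r : ZMod ℓ) : Matrix (Fin P) (Fin P) (ZMod 2) :=
  ∑ u : ZMod ℓ, (F u * G (r - u) + G (r - u) * F u)

/-- The active matrix `H_X`: the first `J` block rows of `Ĥ_X`. -/
def activeHX (ℓ P J : ℕ) (F G : ZMod ℓ → Matrix (Fin P) (Fin P) (ZMod 2)) :
    Matrix (Fin J × Fin P) ((ZMod ℓ ⊕ ZMod ℓ) × Fin P) (ZMod 2) :=
  fun ip jq => parentHX ℓ P F G ((((ip.1 : ℕ) : ZMod ℓ)), ip.2) jq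

/-- The active matrix `H_Z`: the first `J` block rows of `Ĥ_Z`. -/
def activeHZ (ℓ P J : ℕ) (F G : ZMod ℓ → Matrix (Fin P) (Fin P) (ZMod 2)) :
    Matrix (Fin J × Fin P) ((ZMod ℓ ⊕ ZMod ℓ) × Fin P) (ZMod 2) :=
  fun ip jq => parentHZ ℓ P F G ((((ip.1 : ℕ) : ZMod ℓ)), ip.2) jq

theorem parent_block_product_and_active_orthogonality
    (ℓ P J : ℕ) [NeZero ℓ] (hJ : 1 ≤ J) (hJℓ : J ≤ ℓ)
    (F G : ZMod ℓ → Matrix (Fin P) (Fin P) (ZMod 2))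
    (hF : ∀ u, IsPermMat (F u)) (hG : ∀ u, IsPermMat (G u)) :
    (∀ (i k : ZMod ℓ) (p q : Fin P),
        (parentHX ℓ P F G * (parentHZ ℓ P F G).transpose) (i, p) (k, q)
          = Psi ℓ P F G (k - i) p q)
    ∧ ((∀ r : ZMod ℓ,
          (∃ i k : Fin J, r = ((k : ℕ) : ZMod ℓ) - ((i : ℕ) : ZMod ℓ)) →
          Psi ℓ P F G r = 0) →
        activeHX ℓ P J F G * (activeHZ ℓ P J F G).transpose = 0) := by
  have key : ∀ (i k : ZMod ℓ) (p q : Fin P),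
        (parentHX ℓ P F G * (parentHZ ℓ P F G).transpose) (i, p) (k, q)
          = Psi ℓ P F G (k - i) p q := by
    intro i k p q
    have h1 : ∑ j : ZMod ℓ, (F (j - i) * G (k - j)) p q
        = ∑ u : ZMod ℓ, (F u * G (k - i - u)) p q := by
      refine Fintype.sum_equiv (Equiv.subRight i) _ _ fun j => ?_
      have e : k - i - (j - i) = k - j := by ring
      simp only [Equiv.subRight_apply, e]
    have h2 : ∑ j : ZMod ℓ, (G (j - i) * F (k - j)) p q
        = ∑ u : ZMod ℓ, (G (k - i - u) * F u) p q := by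
      refine Fintype.sum_equiv (Equiv.subLeft k) _ _ fun j => ?_
      have e : k - i - (k - j) = j - i := by ring
      simp only [Equiv.subLeft_apply, e]
    simp only [Psi, Matrix.sum_apply, Matrix.add_apply, Finset.sum_add_distrib]
    rw [← h1, ← h2, Matrix.mul_apply, Fintype.sum_prod_type, Fintype.sum_sum_type]
    simp only [Matrix.mul_apply, Matrix.transpose_apply, parentHX, parentHZ]
  refine ⟨key, fun h => ?_⟩
  ext ⟨i, p⟩ ⟨k, q⟩
  have := key ((i : ℕ) : ZMod ℓ) ((k : ℕ) : ZMod ℓ) p q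
  rw [h _ ⟨i, k, rfl⟩] at this
  exact this
end

section
/- Let P = mQ with m ≥ 2, let a, b ∈ Z/PZ with gcd(a,P) = 1, and let M be the P×P permutation matrix over F_2 of the affine permutation x ↦ ax+b (mod P). Let M̄ be the Q×Q permutation matrix of the reduced affine map x ↦ āx+b̄ (mod Q), where ā, b̄ are the reductions of a, b modulo Q (note gcd(ā,Q)=1 since Q divides P). Then M maps the m-block-constant subspace U_m(P) into itself, and for every ū ∈ F_2^Q one has M ι_m(ū) = ι_m(M̄ ū) and π_m(M ι_m(ū)) = M̄ ū. -/
/-!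
STATEMENT 5: Descent of affine permutation matrices on block-constant
subspaces.  With `P = mQ`, `m ≥ 2`, `gcd(a,P) = 1`, the affine permutation
matrix `M` of `x ↦ ax+b (mod P)` preserves the `m`-block-constant subspace
`U_m(P)`, and for every `ū ∈ F_2^Q`, `M ι_m(ū) = ι_m(M̄ ū)` and
`π_m(M ι_m(ū)) = M̄ ū`, where `M̄` is the affine permutation matrix modulo `Q`
of the reduced map.
-/

open Matrix

/-- The affine permutation matrix of `x ↦ a*x + b (mod P)`:
`M e_t = e_{a*t+b}`. -/
def affMat (P : ℕ) (a b : ZMod P) : Matrix (ZMod P) (ZMod P) (ZMod 2) :=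
  fun i t => if i = a * t + b then 1 else 0

/-- `x ∈ F_2^P` is `m`-block constant (with `P = mQ`): constant on every
coset `[t]_m = {t, t+Q, …, t+(m−1)Q}`, i.e. its value depends only on the
residue modulo `Q`. -/
def BlockConst (Q P : ℕ) (h : Q ∣ P) (x : ZMod P → ZMod 2) : Prop :=
  ∀ s t : ZMod P,
    ZMod.castHom h (ZMod Q) s = ZMod.castHom h (ZMod Q) t → x s = x t

/-- The lift `ι_m : F_2^Q → U_m(P)`, `(ι_m x̄)_{t+jQ} = x̄_t`. -/
def blockLift (Q P : ℕ) (h : Q ∣ P) (xbar : ZMod Q → ZMod 2) :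
    ZMod P → ZMod 2 :=
  fun s => xbar (ZMod.castHom h (ZMod Q) s)

/-- The compression `π_m`, `(π_m x)_t := x_t` (value at the coset
representative `t ∈ {0,…,Q−1}`). -/
def blockCompress (Q P : ℕ) (x : ZMod P → ZMod 2) : ZMod Q → ZMod 2 :=
  fun t => x (((ZMod.val t : ℕ) : ZMod P))

theorem affMat_mulVec (P : ℕ) [NeZero P] (a b c : ZMod P) (h : a * c = 1)
    (x : ZMod P → ZMod 2) (i : ZMod P) :
    (affMat P a b).mulVec x i = x (c * (i - b)) := by
  have key : ∀ t : ZMod P, i = a * t + b ↔ t = c * (i - b) := by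
    intro t
    constructor
    · intro e
      rw [e]
      linear_combination (-t) * h
    · intro e
      rw [e]
      linear_combination (b - i) * h
  simp [Matrix.mulVec, dotProduct, affMat, key]

theorem affine_perm_descends_on_block_constant
    (m Q P : ℕ) [NeZero P] [NeZero Q]
    (hm : 2 ≤ m) (hP : P = m * Q) (hQP : Q ∣ P)
    (a b : ZMod P) (ha : Nat.Coprime (ZMod.val a) P) :
    (∀ x : ZMod P → ZMod 2, BlockConst Q P hQP x →
        BlockConst Q P hQP ((affMat P a b).mulVec x))
    ∧ (∀ ubar : ZMod Q → ZMod 2,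
        (affMat P a b).mulVec (blockLift Q P hQP ubar)
          = blockLift Q P hQP
              ((affMat Q (ZMod.castHom hQP (ZMod Q) a)
                         (ZMod.castHom hQP (ZMod Q) b)).mulVec ubar)
        ∧ blockCompress Q P ((affMat P a b).mulVec (blockLift Q P hQP ubar))
            = (affMat Q (ZMod.castHom hQP (ZMod Q) a)
                        (ZMod.castHom hQP (ZMod Q) b)).mulVec ubar) := by
  obtain ⟨c, hc⟩ : ∃ c : ZMod P, a * c = 1 := by
    refine ⟨a⁻¹, ?_⟩
    have := ZMod.coe_mul_inv_eq_one (ZMod.val a) ha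
    simpa using this
  have hc' : ZMod.castHom hQP (ZMod Q) a * ZMod.castHom hQP (ZMod Q) c = 1 := by
    rw [← map_mul, hc, map_one]
  have h1 : ∀ ubar : ZMod Q → ZMod 2,
      (affMat P a b).mulVec (blockLift Q P hQP ubar)
        = blockLift Q P hQP
            ((affMat Q (ZMod.castHom hQP (ZMod Q) a)
                       (ZMod.castHom hQP (ZMod Q) b)).mulVec ubar) := by
    intro ubar
    funext s
    rw [affMat_mulVec P a b c hc]
    unfold blockLift
    rw [affMat_mulVec Q _ _ _ hc', map_mul, map_sub]
  refine ⟨?_, fun ubar => ⟨h1 ubar, ?_⟩⟩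
  · intro x hx s t hst
    rw [affMat_mulVec P a b c hc, affMat_mulVec P a b c hc]
    apply hx
    rw [map_mul, map_mul, map_sub, map_sub, hst]
  · rw [h1]
    funext t
    unfold blockCompress blockLift
    rw [map_natCast, ZMod.natCast_zmod_val]
end

section
/- Let P = mQ with m ≥ 2 and let H ∈ F_2^{rP×NP} be an r×N block matrix each of whose blocks is the permutation matrix of an affine map x ↦ a x + b (mod P) with gcd(a,P) = 1 (coefficients depending on the block). Let H̄ ∈ F_2^{rQ×NQ} be the block matrix whose (i,j) block is the permutation matrix of the corresponding reduced affine map modulo Q. Then for every x̄ ∈ F_2^{NQ}, with x := ι_{m,N}(x̄) the blockwise lift, one has H x = 0 if and only if H̄ x̄ = 0; moreover wt(x) = m·wt(x̄). -/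
/-!
STATEMENT 6: Compression equivalence for block matrices of affine permutation
matrices.  With `P = mQ`, `m ≥ 2`, `H` an `r×N` block matrix of affine
permutation matrices mod `P` (with invertible multipliers) and `H̄` the block
matrix of the reduced affine permutation matrices mod `Q`, for every
`x̄ ∈ F_2^{NQ}` with blockwise lift `x = ι_{m,N}(x̄)` one has
`H x = 0 ↔ H̄ x̄ = 0` and `wt x = m · wt x̄`.
-/

open Matrix

/-- The `r×N` block matrix whose `(i,j)` block is the affine permutation
matrix of `x ↦ a i j * x + b i j (mod P)`. -/
def blockAff (r N P : ℕ) (a b : Fin r → Fin N → ZMod P) :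
    Matrix (Fin r × ZMod P) (Fin N × ZMod P) (ZMod 2) :=
  fun ip jq => affMat P (a ip.1 jq.1) (b ip.1 jq.1) ip.2 jq.2

/-- The blockwise lift `ι_{m,N} : F_2^{NQ} → F_2^{NP}`,
`(ι_{m,N} x̄)_{(j, t+kQ)} = x̄_{(j,t)}`. -/
def blockLiftN (Q P : ℕ) (h : Q ∣ P) (N : ℕ)
    (xbar : Fin N × ZMod Q → ZMod 2) : Fin N × ZMod P → ZMod 2 :=
  fun js => xbar (js.1, ZMod.castHom h (ZMod Q) js.2)

theorem blockAff_mulVec (r N P : ℕ) [NeZero P] (a b c : Fin r → Fin N → ZMod P)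
    (hc : ∀ i j, a i j * c i j = 1) (x : Fin N × ZMod P → ZMod 2) (i : Fin r) (s : ZMod P) :
    (blockAff r N P a b).mulVec x (i, s) = ∑ j, x (j, c i j * (s - b i j)) := by
  simp only [Matrix.mulVec, dotProduct, Fintype.sum_prod_type, blockAff, affMat]
  refine Finset.sum_congr rfl fun j _ => ?_
  rw [Finset.sum_eq_single (c i j * (s - b i j))]
  · rw [if_pos, one_mul]
    linear_combination (-(s - b i j)) * hc i j
  · intro t _ ht
    rw [if_neg, zero_mul]
    rintro rfl
    apply ht
    linear_combination (-t) * hc i j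
  · simp

theorem card_fiber_castHom (m Q P : ℕ) [NeZero P] [NeZero Q] (hP : P = m * Q) (hQP : Q ∣ P)
    (t : ZMod Q) :
    (Finset.univ.filter fun s : ZMod P => ZMod.castHom hQP (ZMod Q) s = t).card = m := by
  have hs := ZMod.castHom_surjective hQP
  have key : ∀ u : ZMod Q,
      (Finset.univ.filter fun s : ZMod P => ZMod.castHom hQP (ZMod Q) s = u).card =
      (Finset.univ.filter fun s : ZMod P => ZMod.castHom hQP (ZMod Q) s = t).card := by
    intro u
    obtain ⟨d, hd⟩ := hs (t - u)
    refine Finset.card_bij' (fun s _ => s + d) (fun s _ => s - d) ?_ ?_ ?_ ?_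
    · intro s h
      simp only [Finset.mem_filter, Finset.mem_univ, true_and] at h ⊢
      rw [map_add, h, hd]; ring
    · intro s h
      simp only [Finset.mem_filter, Finset.mem_univ, true_and] at h ⊢
      rw [map_sub, h, hd]; ring
    · intro s _; ring
    · intro s _; ring
  have h1 := Finset.card_eq_sum_card_fiberwise (s := (Finset.univ : Finset (ZMod P)))
    (t := (Finset.univ : Finset (ZMod Q))) (f := fun s => ZMod.castHom hQP (ZMod Q) s)
    (fun _ _ => Finset.mem_coe.2 (Finset.mem_univ _))
  rw [Finset.sum_congr rfl (fun u _ => key u), Finset.sum_const, Finset.card_univ,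
    Finset.card_univ, ZMod.card, ZMod.card, smul_eq_mul] at h1
  have hQ : 0 < Q := Nat.pos_of_ne_zero (NeZero.ne Q)
  apply Nat.eq_of_mul_eq_mul_left hQ
  rw [← h1, hP, mul_comm]

theorem block_compression_equivalence
    (m Q P : ℕ) [NeZero P] [NeZero Q]
    (hm : 2 ≤ m) (hP : P = m * Q) (hQP : Q ∣ P)
    (r N : ℕ) (a b : Fin r → Fin N → ZMod P)
    (ha : ∀ i j, Nat.Coprime (ZMod.val (a i j)) P)
    (xbar : Fin N × ZMod Q → ZMod 2) :
    ((blockAff r N P a b).mulVec (blockLiftN Q P hQP N xbar) = 0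
      ↔ (blockAff r N Q (fun i j => ZMod.castHom hQP (ZMod Q) (a i j))
                        (fun i j => ZMod.castHom hQP (ZMod Q) (b i j))).mulVec xbar = 0)
    ∧ hammingNorm (blockLiftN Q P hQP N xbar) = m * hammingNorm xbar := by
  constructor
  · have hu : ∀ i j, ∃ c : ZMod P, a i j * c = 1 := by
      intro i j
      refine ⟨(a i j)⁻¹, ?_⟩
      have := ZMod.coe_mul_inv_eq_one _ (ha i j)
      rwa [ZMod.natCast_zmod_val] at this
    choose c hc using hu
    have hs := ZMod.castHom_surjective hQP
    have hc' : ∀ i j, ZMod.castHom hQP (ZMod Q) (a i j) * ZMod.castHom hQP (ZMod Q) (c i j) = 1 :=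
      fun i j => by rw [← map_mul, hc, map_one]
    have e : ∀ i s, (blockAff r N P a b).mulVec (blockLiftN Q P hQP N xbar) (i, s) =
        (blockAff r N Q (fun i j => ZMod.castHom hQP (ZMod Q) (a i j))
          (fun i j => ZMod.castHom hQP (ZMod Q) (b i j))).mulVec xbar
          (i, ZMod.castHom hQP (ZMod Q) s) := by
      intro i s
      rw [blockAff_mulVec r N P a b c hc, blockAff_mulVec r N Q _ _ _ hc']
      simp only [blockLiftN, map_mul, map_sub]
    constructor
    · intro h
      funext ⟨i, t⟩
      obtain ⟨s, rfl⟩ := hs t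
      rw [← e, h]; rfl
    · intro h
      funext ⟨i, s⟩
      rw [e, h]; rfl
  · unfold hammingNorm
    rw [mul_comm]
    rw [Finset.card_eq_sum_card_fiberwise
      (f := fun js : Fin N × ZMod P => (js.1, ZMod.castHom hQP (ZMod Q) js.2))
      (t := Finset.univ.filter fun i => xbar i ≠ 0)]
    · rw [Finset.sum_const_nat (m := m)]
      rintro ⟨j, t⟩ h
      rw [← card_fiber_castHom m Q P hP hQP t]
      simp only [Finset.mem_filter, Finset.mem_univ, true_and] at h
      symm
      refine Finset.card_bij' (fun s _ => (j, s)) (fun p _ => p.2) ?_ ?_ ?_ ?_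
      · intro s hs
        simp only [Finset.mem_filter, Finset.mem_univ, true_and] at hs ⊢
        simp only [blockLiftN, hs]
        exact ⟨h, trivial⟩
      · rintro ⟨j', s⟩ hs
        simp only [Finset.mem_filter, Finset.mem_univ, true_and, Prod.mk.injEq] at hs ⊢
        exact hs.2.2
      · intro s _; rfl
      · rintro ⟨j', s⟩ hs
        simp only [Finset.mem_filter, Finset.mem_univ, true_and, Prod.mk.injEq] at hs ⊢
        exact ⟨hs.2.1.symm, trivial⟩
    · intro p hp
      have hp2 := (Finset.mem_filter.1 (Finset.mem_coe.1 hp)).2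
      exact Finset.mem_coe.2 (Finset.mem_filter.2 ⟨Finset.mem_univ _, hp2⟩)
end

section
/- Let P = mQ with m ≥ 2, and let H_X, H_Z ∈ F_2^{JP×LP} be block matrices all of whose P×P blocks are permutation matrices of affine maps x ↦ ax+b (mod P) with gcd(a,P)=1, satisfying H_X H_Z^T = 0; let H̃_X ∈ F_2^{s×LP} be a further matrix. Let H̄_Z^{(m)} ∈ F_2^{JQ×LQ} be the block matrix of reduced affine permutation matrices modulo Q. Suppose x̄ ∈ Ker(H̄_Z^{(m)}) and set x := ι_{m,L}(x̄). If x ∉ Row(H_X) and x ∉ Row(H̃_X), then x ∈ Ker(H_Z) \ Row(H_X), x ∉ Row(H̃_X), and d_X ≤ wt(x) = m·wt(x̄), where d_X := min{wt(y) : y ∈ Ker(H_Z), y ∉ Row(H_X)}. -/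
/-!
STATEMENT 7: Full-fiber block-compression upper bound.  `H_X, H_Z` are `J×L`
block matrices of affine permutation matrices mod `P = mQ` with
`H_X H_Z^T = 0`; `H̄_Z^{(m)}` is the reduced block matrix mod `Q`.  If
`x̄ ∈ Ker H̄_Z^{(m)}` and the lift `x = ι_{m,L}(x̄)` satisfies `x ∉ Row H_X`
and `x ∉ Row H̃_X`, then `x ∈ Ker H_Z \ Row H_X`, `x ∉ Row H̃_X`, and
`d_X ≤ wt x = m · wt x̄`.
-/

open Matrix

def rowSpace {R ι : Type} (A : Matrix R ι (ZMod 2)) :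
    Submodule (ZMod 2) (ι → ZMod 2) :=
  Submodule.span (ZMod 2) (Set.range A)

noncomputable def dmin {ι : Type} [Fintype ι] (S : Set (ι → ZMod 2)) : ℕ∞ :=
  ⨅ (x : ι → ZMod 2) (_ : x ∈ S), (hammingNorm x : ℕ∞)

theorem affSum (P : ℕ) [NeZero P] (a a' b p : ZMod P) (h : a * a' = 1) (f : ZMod P → ZMod 2) :
    ∑ t, affMat P a b p t * f t = f (a' * (p - b)) := by
  rw [Finset.sum_eq_single (a' * (p - b))]
  · have : p = a * (a' * (p - b)) + b := by
      rw [← mul_assoc, h]; ring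
    simp only [affMat]
    rw [if_pos this, one_mul]
  · intro t _ ht
    simp only [affMat]
    rw [if_neg, zero_mul]
    intro hp
    apply ht
    rw [hp, add_sub_cancel_right, ← mul_assoc, mul_comm a' a, h, one_mul]
  · intro h; exact absurd (Finset.mem_univ _) h

theorem fiberCard (m Q P : ℕ) [NeZero P] [NeZero Q] (hP : P = m * Q) (hQP : Q ∣ P) (q : ZMod Q) :
    (Finset.univ.filter (fun s : ZMod P => ZMod.castHom hQP (ZMod Q) s = q)).card = m := by
  have hs : Function.Surjective (ZMod.castHom hQP (ZMod Q)) := ZMod.castHom_surjective hQP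
  have heq : ∀ q' : ZMod Q,
      (Finset.univ.filter (fun s : ZMod P => ZMod.castHom hQP (ZMod Q) s = q')).card
      = (Finset.univ.filter (fun s : ZMod P => ZMod.castHom hQP (ZMod Q) s = q)).card := by
    intro q'
    obtain ⟨d, hd⟩ := hs (q - q')
    apply Finset.card_bij (fun s _ => s + d)
    · intro s hs'
      simp only [Finset.mem_filter, Finset.mem_univ, true_and] at hs' ⊢
      rw [map_add, hs', hd]; ring
    · intro x _ y _ hxy
      exact add_right_cancel hxy
    · intro s hs'
      simp only [Finset.mem_filter, Finset.mem_univ, true_and] at hs'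
      refine ⟨s - d, ?_, by ring⟩
      simp only [Finset.mem_filter, Finset.mem_univ, true_and]
      rw [map_sub, hs', hd]; ring
  have hc := Finset.card_eq_sum_card_fiberwise (s := (Finset.univ : Finset (ZMod P)))
    (t := (Finset.univ : Finset (ZMod Q))) (f := ZMod.castHom hQP (ZMod Q))
    (fun _ _ => Finset.mem_coe.2 (Finset.mem_univ _))
  rw [Finset.sum_congr rfl (fun q' _ => heq q'), Finset.sum_const, Finset.card_univ,
    Finset.card_univ, ZMod.card, ZMod.card, smul_eq_mul] at hc
  have h0 : 0 < Q := Nat.pos_of_ne_zero (NeZero.ne Q)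
  apply Nat.eq_of_mul_eq_mul_left h0
  rw [← hc, hP, mul_comm]

theorem liftWt (m Q P : ℕ) [NeZero P] [NeZero Q] (hP : P = m * Q) (hQP : Q ∣ P) (L : ℕ)
    (xbar : Fin L × ZMod Q → ZMod 2) :
    hammingNorm (blockLiftN Q P hQP L xbar) = m * hammingNorm xbar := by
  have e1 : ∀ (R : ℕ) [NeZero R] (y : Fin L × ZMod R → ZMod 2),
      hammingNorm y = ∑ j, ∑ t, if y (j, t) ≠ 0 then 1 else 0 := by
    intro R _ y
    rw [← Fintype.sum_prod_type (f := fun z => if y z ≠ 0 then 1 else 0), hammingNorm,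
      Finset.card_filter]
  rw [e1, e1, Finset.mul_sum]
  refine Finset.sum_congr rfl fun j _ => ?_
  rw [← Finset.sum_fiberwise Finset.univ (fun s : ZMod P => ZMod.castHom hQP (ZMod Q) s),
    Finset.mul_sum]
  refine Finset.sum_congr rfl fun q _ => ?_
  rw [Finset.sum_congr rfl (g := fun _ => if xbar (j, q) ≠ 0 then 1 else 0), Finset.sum_const,
    fiberCard m Q P hP hQP, smul_eq_mul]
  intro s hs
  have := (Finset.mem_filter.1 hs).2
  simp only [blockLiftN, this]

theorem liftKer (Q P : ℕ) [NeZero P] [NeZero Q] (hQP : Q ∣ P) (J L : ℕ)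
    (aZ bZ : Fin J → Fin L → ZMod P)
    (haZ : ∀ i j, Nat.Coprime (ZMod.val (aZ i j)) P)
    (xbar : Fin L × ZMod Q → ZMod 2)
    (hxbar : (blockAff J L Q (fun i j => ZMod.castHom hQP (ZMod Q) (aZ i j))
                             (fun i j => ZMod.castHom hQP (ZMod Q) (bZ i j))).mulVec xbar = 0) :
    (blockAff J L P aZ bZ).mulVec (blockLiftN Q P hQP L xbar) = 0 := by
  have hinv : ∀ i j, ∃ a', aZ i j * a' = 1 := by
    intro i j
    have := ZMod.coe_mul_inv_eq_one _ (haZ i j)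
    rw [ZMod.natCast_zmod_val] at this
    exact ⟨_, this⟩
  choose a' ha' using hinv
  funext ⟨i, p⟩
  have h := congrFun hxbar (i, ZMod.castHom hQP (ZMod Q) p)
  refine Eq.trans ?_ h
  simp only [Matrix.mulVec, dotProduct, Fintype.sum_prod_type, blockAff]
  refine Finset.sum_congr rfl fun j _ => ?_
  rw [affSum P _ (a' i j) _ _ (ha' i j) (fun t => blockLiftN Q P hQP L xbar (j, t)),
    affSum Q _ (ZMod.castHom hQP (ZMod Q) (a' i j)) _ _ (by rw [← map_mul, ha', map_one])
      (fun t => xbar (j, t))]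
  simp only [blockLiftN, map_mul, map_sub]

theorem full_fiber_block_compression_upper_bound
    (m Q P : ℕ) [NeZero P] [NeZero Q]
    (hm : 2 ≤ m) (hP : P = m * Q) (hQP : Q ∣ P)
    (J L s : ℕ)
    (aX bX aZ bZ : Fin J → Fin L → ZMod P)
    (haX : ∀ i j, Nat.Coprime (ZMod.val (aX i j)) P)
    (haZ : ∀ i j, Nat.Coprime (ZMod.val (aZ i j)) P)
    (horth : blockAff J L P aX bX * (blockAff J L P aZ bZ).transpose = 0)
    (HtX : Matrix (Fin s) (Fin L × ZMod P) (ZMod 2))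
    (xbar : Fin L × ZMod Q → ZMod 2)
    (hxbar : (blockAff J L Q (fun i j => ZMod.castHom hQP (ZMod Q) (aZ i j))
                             (fun i j => ZMod.castHom hQP (ZMod Q) (bZ i j))).mulVec xbar = 0)
    (hrow : blockLiftN Q P hQP L xbar ∉ rowSpace (blockAff J L P aX bX))
    (hlat : blockLiftN Q P hQP L xbar ∉ rowSpace HtX) :
    ((blockAff J L P aZ bZ).mulVec (blockLiftN Q P hQP L xbar) = 0
      ∧ blockLiftN Q P hQP L xbar ∉ rowSpace (blockAff J L P aX bX)
      ∧ blockLiftN Q P hQP L xbar ∉ rowSpace HtX)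
    ∧ dmin {y | (blockAff J L P aZ bZ).mulVec y = 0
                  ∧ y ∉ rowSpace (blockAff J L P aX bX)}
        ≤ (hammingNorm (blockLiftN Q P hQP L xbar) : ℕ∞)
    ∧ hammingNorm (blockLiftN Q P hQP L xbar) = m * hammingNorm xbar := by
  have hk := liftKer Q P hQP J L aZ bZ haZ xbar hxbar
  exact ⟨⟨hk, hrow, hlat⟩, iInf₂_le _ ⟨hk, hrow⟩, liftWt m Q P hP hQP L xbar⟩
end

section
/- Let P = mQ with m ≥ 2 and let H_X, H_Z ∈ F_2^{JP×LP} and H̃_X ∈ F_2^{sP×LP} be block matrices with H_X H_Z^T = 0, where every P×P block of H̃_X is the permutation matrix of an affine map x ↦ ax+b (mod P) with gcd(a,P) = 1. Assume the kernel hypothesis Ker(H_Z H̃_X^T) ⊆ U_m(sP), i.e., every λ ∈ F_2^{sP} with H_Z H̃_X^T λ = 0 is blockwise m-block constant. Then every x ∈ Ker(H_Z) ∩ Row(H̃_X) lies in U_m(LP), so the compressed latent image L̄_X := π_{m,L}(Ker(H_Z) ∩ Row(H̃_X)) ⊆ F_2^{LQ} is well defined; and if every nonzero vector of L̄_X has Hamming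 weight at least τ_X, then d_X^{lat} ≥ m·τ_X, where d_X^{lat} := min{wt(x) : x ∈ Ker(H_Z) ∩ Row(H̃_X), x ∉ Row(H_X)} (+∞ if the set is empty). -/
/-!
STATEMENT 16: Exact latent lower bounds under block-constant kernel
hypotheses.  `H_X, H_Z` are `JP×LP` matrices with `H_X H_Z^T = 0`, and `H̃_X`
is an `sP×LP` block matrix of affine permutation matrices mod `P = mQ`.  If
every `λ` with `H_Z H̃_X^T λ = 0` is blockwise `m`-block constant, then every
`x ∈ Ker H_Z ∩ Row H̃_X` is blockwise `m`-block constant (so the compressed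
latent image `π_{m,L}(Ker H_Z ∩ Row H̃_X)` is well defined), and if every
nonzero compressed latent vector has weight at least `τ_X`, then
`d_X^{lat} ≥ m·τ_X`.
-/

open Matrix

/-- Blockwise `m`-block constancy on `N` consecutive length-`P` blocks. -/
def BlockConstN (Q P : ℕ) (h : Q ∣ P) (N : ℕ)
    (x : Fin N × ZMod P → ZMod 2) : Prop :=
  ∀ (j : Fin N) (s t : ZMod P),
    ZMod.castHom h (ZMod Q) s = ZMod.castHom h (ZMod Q) t → x (j, s) = x (j, t)

/-- The blockwise compression `π_{m,N}`: value at the coset representative. -/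
def blockCompressN (Q P N : ℕ) (x : Fin N × ZMod P → ZMod 2) :
    Fin N × ZMod Q → ZMod 2 :=
  fun jt => x (jt.1, ((ZMod.val jt.2 : ℕ) : ZMod P))

theorem aux_hamming (m Q P L : ℕ) [NeZero P] [NeZero Q] (hP : P = m * Q) (hQP : Q ∣ P)
    (x : Fin L × ZMod P → ZMod 2) (hx : BlockConstN Q P hQP L x) :
    m * hammingNorm (blockCompressN Q P L x) ≤ hammingNorm x := by
  classical
  have hlt : ∀ (k : Fin m) (q : ZMod Q), q.val + k.1 * Q < P := by
    intro k q
    have h1 := ZMod.val_lt q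
    have h2 : (k.1 + 1) * Q ≤ m * Q := Nat.mul_le_mul_right _ k.2
    rw [hP]; linarith [add_mul k.1 1 Q]
  have key : (Finset.univ ×ˢ Finset.univ.filter
      (fun i => blockCompressN Q P L x i ≠ 0) : Finset (Fin m × (Fin L × ZMod Q))).card ≤
      (Finset.univ.filter (fun i => x i ≠ 0)).card := by
    refine Finset.card_le_card_of_injOn
      (fun p => (p.2.1, ((p.2.2.val + p.1.1 * Q : ℕ) : ZMod P))) ?_ ?_
    · rintro ⟨k, j, q⟩ h
      simp only [Finset.coe_product, Finset.coe_univ, Finset.coe_filter, Set.mem_prod,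
        Set.mem_univ, true_and, Set.mem_ofPred_eq, Finset.mem_univ] at h ⊢
      have := hx j ((q.val + k.1 * Q : ℕ) : ZMod P) ((q.val : ℕ) : ZMod P) (by
        rw [map_natCast, map_natCast]; simp)
      rw [this]; exact h
    · rintro ⟨k, j, q⟩ - ⟨k', j', q'⟩ - h
      simp only [Prod.mk.injEq] at h
      obtain ⟨h1, h2⟩ := h
      have h3 := congrArg ZMod.val h2
      rw [ZMod.val_natCast_of_lt (hlt k q), ZMod.val_natCast_of_lt (hlt k' q')] at h3
      have hq := ZMod.val_lt q
      have hq' := ZMod.val_lt q'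
      have h4 : q.val = q'.val := by
        have := congrArg (· % Q) h3
        simpa [Nat.mod_eq_of_lt hq, Nat.mod_eq_of_lt hq'] using this
      have h5 : k.1 * Q = k'.1 * Q := by omega
      have h6 := Nat.eq_of_mul_eq_mul_right (NeZero.pos Q) h5
      rw [h1, ZMod.val_injective Q h4, Fin.ext h6]
  rw [Finset.card_product, Finset.card_univ, Fintype.card_fin] at key
  exact key

theorem aux_compress_ne (Q P L : ℕ) [NeZero P] [NeZero Q] (hQP : Q ∣ P)
    (x : Fin L × ZMod P → ZMod 2) (hx : BlockConstN Q P hQP L x)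
    (h : blockCompressN Q P L x = 0) : x = 0 := by
  funext ⟨j, t⟩
  have h1 := congrFun h (j, ZMod.castHom hQP (ZMod Q) t)
  rw [hx j t (((ZMod.castHom hQP (ZMod Q) t).val : ℕ) : ZMod P)
    (by rw [map_natCast, ZMod.natCast_zmod_val])]
  exact h1

theorem aux_row (r N P : ℕ) [NeZero P] (a b : Fin r → Fin N → ZMod P)
    (x : Fin N × ZMod P → ZMod 2) (hx : x ∈ rowSpace (blockAff r N P a b)) :
    ∃ lam, (blockAff r N P a b).transpose.mulVec lam = x := by
  obtain ⟨c, hc⟩ := (Submodule.mem_span_range_iff_exists_fun (ZMod 2)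
    (v := fun i => (blockAff r N P a b i : Fin N × ZMod P → ZMod 2))).1 hx
  refine ⟨c, ?_⟩
  rw [← hc]
  funext i
  simp [Matrix.mulVec, dotProduct, Finset.sum_apply, mul_comm]

theorem aux_apply (r N P : ℕ) [NeZero P] (a b : Fin r → Fin N → ZMod P)
    (lam : Fin r × ZMod P → ZMod 2) (j : Fin N) (t : ZMod P) :
    (blockAff r N P a b).transpose.mulVec lam (j, t) = ∑ i, lam (i, a i j * t + b i j) := by
  simp [Matrix.mulVec, dotProduct, Fintype.sum_prod_type, blockAff, affMat]

theorem exact_latent_lower_bound_block_constant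
    (m Q P : ℕ) [NeZero P] [NeZero Q]
    (hm : 2 ≤ m) (hP : P = m * Q) (hQP : Q ∣ P)
    (J L s : ℕ)
    (HX HZ : Matrix (Fin J × ZMod P) (Fin L × ZMod P) (ZMod 2))
    (horth : HX * HZ.transpose = 0)
    (at_ bt : Fin s → Fin L → ZMod P)
    (hat : ∀ i j, Nat.Coprime (ZMod.val (at_ i j)) P)
    (hker : ∀ lam : Fin s × ZMod P → ZMod 2,
        (HZ * (blockAff s L P at_ bt).transpose).mulVec lam = 0 →
        BlockConstN Q P hQP s lam) :
    (∀ x : Fin L × ZMod P → ZMod 2,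
        HZ.mulVec x = 0 → x ∈ rowSpace (blockAff s L P at_ bt) →
        BlockConstN Q P hQP L x)
    ∧ (∀ tauX : ℕ,
        (∀ x : Fin L × ZMod P → ZMod 2,
            HZ.mulVec x = 0 → x ∈ rowSpace (blockAff s L P at_ bt) →
            blockCompressN Q P L x ≠ 0 →
            tauX ≤ hammingNorm (blockCompressN Q P L x)) →
        ((m * tauX : ℕ) : ℕ∞)
          ≤ dmin {x | (HZ.mulVec x = 0 ∧ x ∈ rowSpace (blockAff s L P at_ bt))
                        ∧ x ∉ rowSpace HX}) := by
  have main : ∀ x : Fin L × ZMod P → ZMod 2,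
        HZ.mulVec x = 0 → x ∈ rowSpace (blockAff s L P at_ bt) →
        BlockConstN Q P hQP L x := by
    intro x hx hr
    obtain ⟨lam, rfl⟩ := aux_row _ _ _ _ _ _ hr
    have hl := hker lam (by rw [← Matrix.mulVec_mulVec]; exact hx)
    intro j u t hut
    rw [aux_apply, aux_apply]
    refine Finset.sum_congr rfl fun i _ => hl i _ _ ?_
    rw [map_add, map_add, map_mul, map_mul, hut]
  refine ⟨main, fun tau htau => ?_⟩
  refine le_iInf₂ fun x hx => ?_
  obtain ⟨⟨h1, h2⟩, h3⟩ := hx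
  have hb := main x h1 h2
  have hne : blockCompressN Q P L x ≠ 0 := by
    intro h
    apply h3
    rw [aux_compress_ne Q P L hQP x hb h]
    exact Submodule.zero_mem _
  exact_mod_cast (Nat.mul_le_mul_left m (htau x h1 h2 hne)).trans
    (aux_hamming m Q P L hP hQP x hb)
end

section
/- Let P = mQ with m ≥ 2 and let M be the P×P permutation matrix over F_2 of an affine permutation x ↦ ax+b (mod P) with gcd(a,P) = 1. Then for every block matrix H whose blocks are such affine permutation matrices, and every vector x in the blockwise m-block-constant subspace, the product H x is again blockwise m-block constant; in particular, each single affine permutation matrix M satisfies M(U_m(P)) ⊆ U_m(P), because the affine map sends each coset [t]_m = {t, t+Q, …, t+(m−1)Q} onto the coset [at+b]_m. -/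
/-!
STATEMENT 19: Affine permutation matrices preserve blockwise `m`-block
constancy.  For any block matrix `H` of affine permutation matrices mod
`P = mQ` (invertible multipliers), `H x` is blockwise `m`-block constant
whenever `x` is; in particular each single affine permutation matrix maps
`U_m(P)` into itself, because the affine map sends the coset `[t]_m` onto the
coset `[a·t+b]_m` (reduction mod `Q` intertwines the affine maps).
-/

open Matrix

theorem affMat_mulVec_eq (P : ℕ) [NeZero P] (a b : ZMod P) (ha : Nat.Coprime (ZMod.val a) P)
    (x : ZMod P → ZMod 2) (s : ZMod P) :
    (affMat P a b).mulVec x s = x (a⁻¹ * (s - b)) := by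
  have h1 : a * a⁻¹ = 1 := by
    have := ZMod.coe_mul_inv_eq_one (n := P) a.val ha
    rwa [ZMod.natCast_zmod_val] at this
  have key : ∀ t : ZMod P, s = a * t + b ↔ t = a⁻¹ * (s - b) := by
    intro t
    constructor
    · intro h
      rw [h]
      linear_combination (-t) * h1
    · intro h
      rw [h]
      linear_combination (b - s) * h1
  simp only [Matrix.mulVec, dotProduct, affMat, key, ite_mul, one_mul, zero_mul]
  simp

theorem affMat_blockConst (Q P : ℕ) [NeZero P] (hQP : Q ∣ P) (a b : ZMod P)
    (ha : Nat.Coprime (ZMod.val a) P)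
    (x : ZMod P → ZMod 2) (hx : BlockConst Q P hQP x) :
    BlockConst Q P hQP ((affMat P a b).mulVec x) := by
  intro s t h
  rw [affMat_mulVec_eq P a b ha, affMat_mulVec_eq P a b ha]
  apply hx
  rw [map_mul, map_mul, map_sub, map_sub, h]

theorem affine_blocks_preserve_block_constancy
    (m Q P : ℕ) [NeZero P] [NeZero Q]
    (hm : 2 ≤ m) (hP : P = m * Q) (hQP : Q ∣ P) :
    (∀ (r N : ℕ) (a b : Fin r → Fin N → ZMod P),
        (∀ i j, Nat.Coprime (ZMod.val (a i j)) P) →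
        ∀ x : Fin N × ZMod P → ZMod 2, BlockConstN Q P hQP N x →
          BlockConstN Q P hQP r ((blockAff r N P a b).mulVec x))
    ∧ (∀ a b : ZMod P, Nat.Coprime (ZMod.val a) P →
        ∀ x : ZMod P → ZMod 2, BlockConst Q P hQP x →
          BlockConst Q P hQP ((affMat P a b).mulVec x))
    ∧ (∀ a b : ZMod P, Nat.Coprime (ZMod.val a) P →
        ∀ s t : ZMod P,
          ZMod.castHom hQP (ZMod Q) s = ZMod.castHom hQP (ZMod Q) t →
          ZMod.castHom hQP (ZMod Q) (a * s + b)
            = ZMod.castHom hQP (ZMod Q) (a * t + b)) := by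
  refine ⟨?_, fun a b ha x hx => affMat_blockConst Q P hQP a b ha x hx, ?_⟩
  · intro r N a b ha x hx i s t h
    have e : ∀ u : ZMod P, (blockAff r N P a b).mulVec x (i, u)
        = ∑ j, (affMat P (a i j) (b i j)).mulVec (fun q => x (j, q)) u := by
      intro u
      simp only [Matrix.mulVec, dotProduct, blockAff, Fintype.sum_prod_type]
    rw [e, e]
    refine Finset.sum_congr rfl fun j _ => ?_
    exact affMat_blockConst Q P hQP _ _ (ha i j) _ (fun s t h => hx j s t h) s t h
  · intro a b _ s t h
    rw [map_add, map_add, map_mul, map_mul, h]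
end
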